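/- Let $n\in\{1,2,3,\dots\}$, $0<q<1$, and let $(\mu_i)_{i=1}^n$ be probability measures on $\mathbb{R}$ with cumulative distribution functions $F_i(t)=\mu_i((-\infty,t])$ and quantile functions $F_i^{-1}:(0,1)\to\mathbb{R}$, $F_i^{-1}(s)=\inf\{t\in\mathbb{R}:F_i(t)\ge s\}$. Let $\Phi$ be the standard normal cumulative distribution function, and suppose that for all $1\le i\le n$ and all $s\in\mathbb{R}$, $$\mathrm{Lip}(F_i^{-1}\circ\Phi,s)\le(1+|s|)^{-1+2/q},$$ where $\mathrm{Lip}(T,x)=\lim_{\varepsilon\to0^+}\mathrm{Lip}(T|_{B(x,\varepsilon)})\in[0,\infty]$ denotes the local Lipschitz constant of $T$ at $x$. Let $f:\mathbb{R}^n\to\mathbb{R}$ be differentiable, put $\mathrm{Lip}_s(f)=\sup_{x\in\mathbb{R}^n}|\nabla f(x)|_s\in[0,\infty]$ for $s\in\{2,\infty\}$, where $|\cdot|_s$ is the $\ell_s$ norm, and let $X=(X_i)_{i=1}^n$ be a vector of independent random variables with $X_i$ distributed according to $\mu_i$. Let $\mathbb{M}f(X)$ be any median of $f(X)$. Then there exists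 a constant $C_q>0$, depending only on $q$, such that for all $t>0$, $$\mathbb{P}\left\{|f(X)-\mathbb{M}f(X)|>C_q\left(\log\left(e+\frac{n}{t^{-2+4/q}}\right)\right)^{1/q-1/2}\left(t\,\mathrm{Lip}_2(f)+t^{2/q}\,\mathrm{Lip}_\infty(f)\right)\right\}\le2\exp(-t^2/2).$$ (If $\mathrm{Lip}_2(f)=\infty$ the right-hand side of the inequality defining the event is $\infty$ and the claim is trivial.) -/

import Mathlib

open MeasureTheory ProbabilityTheory Set Filter Topology
open scoped ENNReal

/-- The least Lipschitz constant, in `[0, ∞]`, of the restriction of `T` to `S`. -/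
noncomputable def lipConstOn {α β : Type*} [PseudoEMetricSpace α] [PseudoEMetricSpace β]
    (T : α → β) (S : Set α) : ℝ≥0∞ :=
  sInf {K : ℝ≥0∞ | ∀ x ∈ S, ∀ y ∈ S, edist (T x) (T y) ≤ K * edist x y}

/-- The local Lipschitz constant `Lip(T, x)`, in `[0, ∞]`. The Lipschitz constant of `T` on
`B(x, ε)` is nondecreasing in `ε`, so that its limit as `ε → 0⁺` is its infimum over `ε > 0`
(see `tendsto_lipConstOn_ball`). -/
noncomputable def localLip {α β : Type*} [PseudoMetricSpace α] [PseudoMetricSpace β]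
    (T : α → β) (x : α) : ℝ≥0∞ :=
  ⨅ ε : Ioi (0 : ℝ), lipConstOn T (Metric.ball x ε)

theorem lipConstOn_mono {α β : Type*} [PseudoEMetricSpace α] [PseudoEMetricSpace β]
    (T : α → β) {S S' : Set α} (h : S ⊆ S') : lipConstOn T S ≤ lipConstOn T S' :=
  sInf_le_sInf fun _ hK x hx y hy => hK x (h hx) y (h hy)

theorem tendsto_lipConstOn_ball {α β : Type*} [PseudoMetricSpace α] [PseudoMetricSpace β]
    (T : α → β) (x : α) :
    Tendsto (fun ε : ℝ => lipConstOn T (Metric.ball x ε)) (𝓝[>] 0) (𝓝 (localLip T x)) := by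
  have hm : Monotone fun ε : ℝ => lipConstOn T (Metric.ball x ε) :=
    fun a b hab => lipConstOn_mono T (Metric.ball_subset_ball hab)
  have h := hm.tendsto_nhdsGT 0
  rwa [sInf_image'] at h

/-- The quantile function `F⁻¹(s) = inf {t : F(t) ≥ s}`, where `F` is the cumulative distribution
function of `μ`. It is meaningful for `0 < s < 1`. -/
noncomputable def quantile (μ : Measure ℝ) (s : ℝ) : ℝ :=
  sInf {t : ℝ | s ≤ cdf μ t}

/-- `Lip_s(f) = sup_x |∇f(x)|_s`, in `[0, ∞]`, where `|·|_s` is the `ℓ_s` norm on `ℝⁿ`. -/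
noncomputable def gradLip {n : ℕ} (s : ℝ≥0∞) (f : (Fin n → ℝ) → ℝ) : ℝ≥0∞ :=
  ⨆ x : Fin n → ℝ,
    ENNReal.ofReal ‖WithLp.toLp s (fun i : Fin n => fderiv ℝ f x (Pi.single i 1))‖

/-- `m` is a median of the random variable `Y`. -/
def IsMedian {Ω : Type*} [MeasurableSpace Ω] (m : ℝ) (Y : Ω → ℝ) (P : Measure Ω) : Prop :=
  1 / 2 ≤ P {ω | Y ω ≤ m} ∧ 1 / 2 ≤ P {ω | m ≤ Y ω}

/-! ### Gaussian concentration for Lipschitz functions -/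

section Concentration

variable {E : Type*} [NormedAddCommGroup E] [InnerProductSpace ℝ E] [FiniteDimensional ℝ E]
  [MeasurableSpace E] [BorelSpace E]

/-- Jensen's inequality for the exponential, in `ℝ≥0∞`. -/
theorem ofReal_exp_integral_le_lintegral {α : Type*} [MeasurableSpace α] {ν : Measure α}
    [IsProbabilityMeasure ν] {g : α → ℝ} (hg : Integrable g ν)
    (hexp : Integrable (fun x => Real.exp (g x)) ν) :
    ENNReal.ofReal (Real.exp (∫ x, g x ∂ν)) ≤ ∫⁻ x, ENNReal.ofReal (Real.exp (g x)) ∂ν := by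
  rw [← ofReal_integral_eq_lintegral_ofReal hexp (ae_of_all _ fun _ => (Real.exp_pos _).le)]
  exact ENNReal.ofReal_le_ofReal (convexOn_exp.map_integral_le Real.continuous_exp.continuousOn
    isClosed_univ (by simp) hg hexp)

theorem lintegral_exp_dual_stdGaussian (L : StrongDual ℝ E) :
    ∫⁻ y, ENNReal.ofReal (Real.exp (L y)) ∂(stdGaussian E)
      = ENNReal.ofReal (Real.exp (‖L‖ ^ 2 / 2)) := by
  have hmap : (stdGaussian E).map L = gaussianReal 0 (‖L‖ ^ 2).toNNReal := by
    rw [IsGaussian.map_eq_gaussianReal L, integral_strongDual_stdGaussian,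
      variance_dual_stdGaussian]
  have hmgf := mgf_gaussianReal hmap 1
  have hinteg : Integrable (fun y => Real.exp (L y)) (stdGaussian E) := by
    have h := integrable_exp_mul_gaussianReal (μ := 0) (v := (‖L‖ ^ 2).toNNReal) 1
    rw [← hmap, integrable_map_measure (by fun_prop) (by fun_prop)] at h
    simpa [Function.comp_def] using h
  rw [← ofReal_integral_eq_lintegral_ofReal hinteg (ae_of_all _ fun _ => (Real.exp_pos _).le)]
  congr 1
  simpa [mgf] using hmgf

/-- The Maurey–Pisier exponential inequality for continuously differentiable functions. -/
theorem lintegral_exp_sub_le_of_contDiff {F : E → ℝ} (hF : ContDiff ℝ 1 F) {D : ℝ}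
    (hD : ∀ x, ‖fderiv ℝ F x‖ ≤ D) :
    ∫⁻ p, ENNReal.ofReal (Real.exp (F p.2 - F p.1)) ∂((stdGaussian E).prod (stdGaussian E))
      ≤ ENNReal.ofReal (Real.exp (2 * D ^ 2)) := by
  set γ := stdGaussian E
  have : ProperSpace E := FiniteDimensional.proper_real E
  set ν : Measure ℝ := volume.restrict (Ioc 0 1)
  have : IsProbabilityMeasure ν := ⟨by simp [ν]⟩
  obtain ⟨rot, hrot⟩ : ∃ rot : ℝ → E × E → E × E,
      rot = fun s => ⇑(ContinuousLinearMap.rotation (E := E) (Real.pi / 2 * s)) := ⟨_, rfl⟩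
  have hrot1 : ∀ s p, (rot s p).1
      = Real.cos (Real.pi / 2 * s) • p.1 + Real.sin (Real.pi / 2 * s) • p.2 := fun s p => by
    simp [hrot, ContinuousLinearMap.rotation_apply]
  have hrot2 : ∀ s p, (rot s p).2
      = -Real.sin (Real.pi / 2 * s) • p.1 + Real.cos (Real.pi / 2 * s) • p.2 := fun s p => by
    simp [hrot, ContinuousLinearMap.rotation_apply]
  set k : E × E → ℝ := fun p => Real.pi / 2 * fderiv ℝ F p.1 p.2
  have hfc : Continuous (fderiv ℝ F) := hF.continuous_fderiv one_ne_zero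
  have hk : Continuous k :=
    continuous_const.mul ((hfc.comp continuous_fst).clm_apply continuous_snd)
  have hrotc : Continuous fun z : (E × E) × ℝ => rot z.2 z.1 := by
    have : (fun z : (E × E) × ℝ => rot z.2 z.1) = fun z : (E × E) × ℝ =>
        (Real.cos (Real.pi / 2 * z.2) • z.1.1 + Real.sin (Real.pi / 2 * z.2) • z.1.2,
        -Real.sin (Real.pi / 2 * z.2) • z.1.1 + Real.cos (Real.pi / 2 * z.2) • z.1.2) := by
      funext z
      exact Prod.ext (hrot1 _ _) (hrot2 _ _)
    rw [this]
    fun_prop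
  have hkr : Continuous fun z : (E × E) × ℝ => k (rot z.2 z.1) := hk.comp hrotc
  have hkr' : ∀ p, Continuous fun s : ℝ => k (rot s p) := fun p =>
    hkr.comp (Continuous.prodMk_right p)
  have hinteg : ∀ g : ℝ → ℝ, Continuous g → Integrable g ν := fun g hg =>
    (hg.integrableOn_Icc (a := 0) (b := 1)).mono_set Ioc_subset_Icc_self
  have hderiv : ∀ p s, HasDerivAt (fun s => F (rot s p).1) (k (rot s p)) s := by
    intro p s
    have hθ : HasDerivAt (fun s : ℝ => Real.pi / 2 * s) (Real.pi / 2) s := by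
      simpa using (hasDerivAt_id s).const_mul (Real.pi / 2)
    have h1 : HasDerivAt (fun s => (rot s p).1) ((Real.pi / 2) • (rot s p).2) s := by
      simp_rw [hrot1, hrot2]
      have := (hθ.cos.smul_const p.1).add (hθ.sin.smul_const p.2)
      refine this.congr_deriv ?_
      simp only [smul_add, smul_smul]
      congr 2 <;> ring
    have h2 := ((hF.differentiable one_ne_zero) (rot s p).1).hasFDerivAt.comp_hasDerivAt s h1
    refine h2.congr_deriv ?_
    simp [k]
  have hftc : ∀ p : E × E, ∫ s, k (rot s p) ∂ν = F p.2 - F p.1 := by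
    intro p
    have := intervalIntegral.integral_eq_sub_of_hasDerivAt (a := 0) (b := 1)
      (fun s _ => hderiv p s) ((hkr' p).intervalIntegrable _ _)
    rw [intervalIntegral.integral_of_le zero_le_one] at this
    rw [this, hrot1, hrot1]
    simp
  have hmeas : Measurable fun z : (E × E) × ℝ => ENNReal.ofReal (Real.exp (k (rot z.2 z.1))) :=
    (Real.continuous_exp.comp hkr).measurable.ennreal_ofReal
  have hinv : ∀ s, (γ.prod γ).map (rot s) = γ.prod γ := fun s => by
    rw [hrot]
    exact IsGaussian.map_rotation_eq_self_of_forall_strongDual_eq_zero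
      integral_strongDual_stdGaussian _
  have hconst : ∀ s, ∫⁻ p, ENNReal.ofReal (Real.exp (k (rot s p))) ∂(γ.prod γ)
      ≤ ENNReal.ofReal (Real.exp (2 * D ^ 2)) := by
    intro s
    have hkm : Measurable fun p : E × E => ENNReal.ofReal (Real.exp (k p)) :=
      (Real.continuous_exp.comp hk).measurable.ennreal_ofReal
    have hrm : Measurable (rot s) := by
      rw [hrot]
      exact (ContinuousLinearMap.continuous _).measurable
    rw [← lintegral_map hkm hrm, hinv, lintegral_prod _ hkm.aemeasurable]
    calc ∫⁻ x, ∫⁻ y, ENNReal.ofReal (Real.exp (k (x, y))) ∂γ ∂γ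
        ≤ ∫⁻ _, ENNReal.ofReal (Real.exp (2 * D ^ 2)) ∂γ := by
          refine lintegral_mono fun x => ?_
          have := lintegral_exp_dual_stdGaussian ((Real.pi / 2) • fderiv ℝ F x)
          simp only [FunLike.coe_smul, Pi.smul_apply, smul_eq_mul] at this
          simp only [k]
          rw [this]
          refine ENNReal.ofReal_le_ofReal (Real.exp_le_exp.2 ?_)
          rw [norm_smul, mul_pow, Real.norm_eq_abs, sq_abs]
          have h1 : ‖fderiv ℝ F x‖ ^ 2 ≤ D ^ 2 :=
            pow_le_pow_left₀ (norm_nonneg _) (hD x) 2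
          have h2 : (Real.pi / 2) ^ 2 ≤ 4 := by nlinarith [Real.pi_pos, Real.pi_le_four]
          nlinarith [sq_nonneg ‖fderiv ℝ F x‖]
      _ = _ := by simp
  calc ∫⁻ p, ENNReal.ofReal (Real.exp (F p.2 - F p.1)) ∂(γ.prod γ)
      ≤ ∫⁻ p, ∫⁻ s, ENNReal.ofReal (Real.exp (k (rot s p))) ∂ν ∂(γ.prod γ) := by
        refine lintegral_mono fun p => ?_
        rw [← hftc p]
        exact ofReal_exp_integral_le_lintegral (hinteg _ (hkr' p))
          (hinteg _ (Real.continuous_exp.comp (hkr' p)))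
    _ = ∫⁻ s, ∫⁻ p, ENNReal.ofReal (Real.exp (k (rot s p))) ∂(γ.prod γ) ∂ν :=
        lintegral_lintegral_swap hmeas.aemeasurable
    _ ≤ ∫⁻ _, ENNReal.ofReal (Real.exp (2 * D ^ 2)) ∂ν := lintegral_mono hconst
    _ = _ := by simp

/-- Uniform approximation of a Lipschitz function by continuously differentiable functions with
the same Lipschitz constant. -/
theorem exists_contDiff_approx_of_lipschitzWith {F : E → ℝ} {D : NNReal} (hF : LipschitzWith D F)
    {ε : ℝ} (hε : 0 < ε) :
    ∃ G : E → ℝ, ContDiff ℝ 1 G ∧ (∀ x, ‖fderiv ℝ G x‖ ≤ D) ∧ ∀ x, |G x - F x| ≤ ε := by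
  have : ProperSpace E := FiniteDimensional.proper_real E
  set r : ℝ := ε / (D + 1)
  have hD : (0 : ℝ) < D + 1 := by positivity
  have hr : 0 < r := div_pos hε hD
  let φ : ContDiffBump (0 : E) := ⟨r / 2, r, half_pos hr, half_lt_self hr⟩
  let G : E → ℝ := convolution (φ.normed volume) F (ContinuousLinearMap.lsmul ℝ ℝ) volume
  have hGdef : ∀ x, G x = ∫ t, φ.normed volume t * F (x - t) := fun x => by
    simp [G, convolution_def]
  have hG : ContDiff ℝ 1 G := φ.hasCompactSupport_normed.contDiff_convolution_left _
    φ.contDiff_normed hF.continuous.locallyIntegrable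
  have hinteg : ∀ x, Integrable fun t => φ.normed volume t * F (x - t) := fun x =>
    (Continuous.integrable_of_hasCompactSupport
      (φ.continuous_normed.mul (hF.continuous.comp (by fun_prop)))
      φ.hasCompactSupport_normed.mul_right)
  have hlip : LipschitzWith D G := by
    refine LipschitzWith.of_dist_le_mul fun x y => ?_
    rw [hGdef, hGdef, Real.dist_eq, ← integral_sub (hinteg x) (hinteg y), ← Real.norm_eq_abs]
    calc ‖∫ t, (φ.normed volume t * F (x - t) - φ.normed volume t * F (y - t))‖
        ≤ ∫ t, φ.normed volume t * (D * dist x y) := by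
          refine norm_integral_le_of_norm_le (φ.integrable_normed.mul_const _)
            (ae_of_all _ fun t => ?_)
          rw [← mul_sub, norm_mul, Real.norm_of_nonneg (φ.nonneg_normed t)]
          refine mul_le_mul_of_nonneg_left ?_ (φ.nonneg_normed t)
          have := hF.dist_le_mul (x - t) (y - t)
          rwa [dist_sub_right, Real.dist_eq] at this
      _ = D * dist x y := by rw [integral_mul_const, φ.integral_normed, one_mul]
  refine ⟨G, hG, fun x => norm_fderiv_le_of_lipschitz ℝ hlip, fun x => ?_⟩
  rw [← Real.dist_eq]
  refine φ.dist_normed_convolution_le hF.continuous.aestronglyMeasurable fun y hy => ?_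
  refine (hF.dist_le_mul y x).trans ?_
  have hy' : dist y x ≤ r := (Metric.mem_ball.1 hy).le
  calc (D : ℝ) * dist y x ≤ (D + 1) * r := by gcongr; linarith
    _ = ε := by simp only [r]; field_simp

theorem lintegral_exp_sub_le_of_lipschitzWith {F : E → ℝ} {D : NNReal} (hF : LipschitzWith D F) :
    ∫⁻ p, ENNReal.ofReal (Real.exp (F p.2 - F p.1)) ∂((stdGaussian E).prod (stdGaussian E))
      ≤ ENNReal.ofReal (Real.exp (2 * (D : ℝ) ^ 2)) := by
  have key : ∀ ε : ℝ, 0 < ε →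
      ∫⁻ p, ENNReal.ofReal (Real.exp (F p.2 - F p.1)) ∂((stdGaussian E).prod (stdGaussian E))
        ≤ ENNReal.ofReal (Real.exp (2 * ε + 2 * (D : ℝ) ^ 2)) := by
    intro ε hε
    obtain ⟨G, hG, hGD, hGF⟩ := exists_contDiff_approx_of_lipschitzWith hF hε
    calc ∫⁻ p, ENNReal.ofReal (Real.exp (F p.2 - F p.1)) ∂((stdGaussian E).prod (stdGaussian E))
        ≤ ∫⁻ p, ENNReal.ofReal (Real.exp (2 * ε)) * ENNReal.ofReal (Real.exp (G p.2 - G p.1))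
            ∂((stdGaussian E).prod (stdGaussian E)) := by
          refine lintegral_mono fun p => ?_
          rw [← ENNReal.ofReal_mul (Real.exp_pos _).le, ← Real.exp_add]
          refine ENNReal.ofReal_le_ofReal (Real.exp_le_exp.2 ?_)
          have h1 := abs_le.1 (hGF p.1)
          have h2 := abs_le.1 (hGF p.2)
          linarith
      _ ≤ ENNReal.ofReal (Real.exp (2 * ε)) * ENNReal.ofReal (Real.exp (2 * (D : ℝ) ^ 2)) := by
          rw [lintegral_const_mul' _ _ ENNReal.ofReal_ne_top]
          gcongr
          exact lintegral_exp_sub_le_of_contDiff hG hGD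
      _ = _ := by rw [← ENNReal.ofReal_mul (Real.exp_pos _).le, ← Real.exp_add]
  have hlim : Tendsto (fun ε : ℝ => ENNReal.ofReal (Real.exp (2 * ε + 2 * (D : ℝ) ^ 2))) (𝓝[>] 0)
      (𝓝 (ENNReal.ofReal (Real.exp (2 * (D : ℝ) ^ 2)))) := by
    have : Continuous fun ε : ℝ => ENNReal.ofReal (Real.exp (2 * ε + 2 * (D : ℝ) ^ 2)) :=
      ENNReal.continuous_ofReal.comp (by fun_prop)
    have h := (this.tendsto 0).mono_left (nhdsWithin_le_nhds (s := Ioi (0 : ℝ)))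
    simpa using h
  exact ge_of_tendsto hlim (eventually_nhdsWithin_of_forall key)

/-- Gaussian concentration of a Lipschitz function above a level `m` which it does not exceed with
probability at least `1 / 4`. -/
theorem stdGaussian_upper_tail {F : E → ℝ} {D : NNReal} (hF : LipschitzWith D F) {m : ℝ}
    (hm : 1 / 4 ≤ stdGaussian E {x | F x ≤ m}) {t : ℝ} (ht0 : 0 < t)
    (ht : 2 * Real.log 2 ≤ t ^ 2) :
    stdGaussian E {x | m + 5 * t * D < F x} ≤ ENNReal.ofReal (1 / 4 * Real.exp (-t ^ 2 / 2)) := by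
  set γ := stdGaussian E
  rcases eq_or_ne D 0 with rfl | hD
  · have hne : {x | F x ≤ m}.Nonempty := by
      by_contra h
      rw [not_nonempty_iff_eq_empty.1 h] at hm
      simp at hm
    obtain ⟨x₀, hx₀⟩ := hne
    have : {x | m + 5 * t * ((0 : NNReal) : ℝ) < F x} = ∅ := by
      refine eq_empty_of_forall_notMem fun x hx => ?_
      have h := hF.dist_le_mul x x₀
      simp only [NNReal.coe_zero, zero_mul, mul_zero, add_zero, mem_ofPred_eq] at h hx hx₀
      have := dist_le_zero.1 h
      linarith
    rw [this]
    simp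
  have hD0 : (0 : ℝ) < D := by positivity
  set l : ℝ := 5 * t / (4 * D)
  have hl : 0 < l := by positivity
  have hlip : LipschitzWith (l.toNNReal * D) fun x => l * F x := by
    refine LipschitzWith.of_dist_le_mul fun x y => ?_
    have := hF.dist_le_mul x y
    rw [Real.dist_eq] at this
    rw [Real.dist_eq, ← mul_sub, abs_mul, abs_of_pos hl, NNReal.coe_mul, Real.coe_toNNReal l hl.le,
      mul_assoc]
    gcongr
  have hexp := lintegral_exp_sub_le_of_lipschitzWith hlip
  have hmF : Measurable F := hF.continuous.measurable
  set A := {x | F x ≤ m}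
  set B := {x | m + 5 * t * D < F x}
  have hprod : γ A * γ B ≤ (γ.prod γ) {p | ENNReal.ofReal (Real.exp (l * (5 * t * D)))
      ≤ ENNReal.ofReal (Real.exp (l * F p.2 - l * F p.1))} := by
    rw [← Measure.prod_prod]
    refine measure_mono fun p hp => ?_
    obtain ⟨h1, h2⟩ := hp
    simp only [A, B, mem_ofPred_eq] at h1 h2
    refine ENNReal.ofReal_le_ofReal (Real.exp_le_exp.2 ?_)
    rw [← mul_sub]
    exact mul_le_mul_of_nonneg_left (by linarith) hl.le
  have hmarkov := mul_meas_ge_le_lintegral₀ (μ := γ.prod γ)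
    (f := fun p : E × E => ENNReal.ofReal (Real.exp (l * F p.2 - l * F p.1))) (by fun_prop)
    (ENNReal.ofReal (Real.exp (l * (5 * t * D))))
  have hfin : γ B ≠ ∞ := measure_ne_top _ _
  have hall : ENNReal.ofReal (Real.exp (l * (5 * t * D))) * (1 / 4 * γ B)
      ≤ ENNReal.ofReal (Real.exp (2 * ((l.toNNReal * D : NNReal) : ℝ) ^ 2)) := by
    refine le_trans ?_ (hmarkov.trans hexp)
    gcongr
    refine le_trans ?_ hprod
    gcongr
  rw [← ENNReal.ofReal_toReal hfin] at hall ⊢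
  set b := (γ B).toReal
  have hb : 0 ≤ b := ENNReal.toReal_nonneg
  have h14 : (1 / 4 : ℝ≥0∞) = ENNReal.ofReal (1 / 4) := by
    rw [ENNReal.ofReal_div_of_pos (by norm_num)]
    simp
  rw [h14, ← ENNReal.ofReal_mul (by norm_num), ← ENNReal.ofReal_mul (Real.exp_pos _).le,
    ENNReal.ofReal_le_ofReal_iff (Real.exp_pos _).le, NNReal.coe_mul,
    Real.coe_toNNReal l hl.le] at hall
  refine ENNReal.ofReal_le_ofReal ?_
  have e1 : l * (5 * t * D) = 25 / 4 * t ^ 2 := by simp only [l]; field_simp; ring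
  have e2 : 2 * (l * D) ^ 2 = 25 / 8 * t ^ 2 := by simp only [l]; field_simp; ring
  rw [e1, e2] at hall
  have h16 : (16 : ℝ) ≤ Real.exp (2 * t ^ 2) := by
    have : (16 : ℝ) = Real.exp (4 * Real.log 2) := by
      rw [mul_comm, Real.exp_mul, Real.exp_log two_pos]; norm_num
    rw [this]
    exact Real.exp_le_exp.2 (by linarith)
  have hpos := Real.exp_pos (25 / 4 * t ^ 2)
  have hb4 : b ≤ 4 * Real.exp (-(25 / 8) * t ^ 2) := by
    have : Real.exp (25 / 8 * t ^ 2)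
        = Real.exp (25 / 4 * t ^ 2) * Real.exp (-(25 / 8) * t ^ 2) := by
      rw [← Real.exp_add]; ring_nf
    rw [this] at hall
    have := le_of_mul_le_mul_left hall hpos
    linarith
  have hlast : 16 * Real.exp (-(25 / 8) * t ^ 2) ≤ Real.exp (-t ^ 2 / 2) := by
    calc 16 * Real.exp (-(25 / 8) * t ^ 2)
        ≤ Real.exp (2 * t ^ 2) * Real.exp (-(25 / 8) * t ^ 2) := by gcongr
      _ = Real.exp (2 * t ^ 2 + -(25 / 8) * t ^ 2) := by rw [Real.exp_add]
      _ ≤ _ := Real.exp_le_exp.2 (by nlinarith [sq_nonneg t])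
  linarith

/-- Gaussian concentration around a median for a function that is Lipschitz on a set of large
measure. -/
theorem stdGaussian_concentration_of_lipschitzOnWith {h : E → ℝ} {D : NNReal} {K : Set E}
    (hh : LipschitzOnWith D h K) {m : ℝ} (hm₁ : 1 / 2 ≤ stdGaussian E {x | h x ≤ m})
    (hm₂ : 1 / 2 ≤ stdGaussian E {x | m ≤ h x}) {t : ℝ} (ht0 : 0 < t)
    (ht : 2 * Real.log 2 ≤ t ^ 2)
    (hK : stdGaussian E Kᶜ ≤ ENNReal.ofReal (1 / 4 * Real.exp (-t ^ 2 / 2))) :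
    stdGaussian E {x | 5 * t * D < |h x - m|} ≤ ENNReal.ofReal (2 * Real.exp (-t ^ 2 / 2)) := by
  obtain ⟨g, hg, hgh⟩ := hh.extend_real
  set γ := stdGaussian E
  set δ := Real.exp (-t ^ 2 / 2)
  have hδ0 : 0 < δ := Real.exp_pos _
  have hδ : δ ≤ 1 := Real.exp_le_one_iff.2 (by nlinarith [sq_nonneg t])
  have hquarter : ∀ A B : Set E, A ∩ K ⊆ B → 1 / 2 ≤ γ A → 1 / 4 ≤ γ B := by
    intro A B hAB hA
    have h1 : γ A ≤ γ B + γ Kᶜ := by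
      refine (measure_mono fun x hx => ?_).trans (measure_union_le B Kᶜ)
      by_cases hxK : x ∈ K
      · exact Or.inl (hAB ⟨hx, hxK⟩)
      · exact Or.inr hxK
    have h2 : γ Kᶜ ≤ 1 / 4 := by
      refine hK.trans ?_
      refine (ENNReal.ofReal_le_ofReal (by linarith : 1 / 4 * δ ≤ 1 / 4)).trans (le_of_eq ?_)
      rw [ENNReal.ofReal_div_of_pos (by norm_num)]
      simp
    have h3 : (1 / 4 : ℝ≥0∞) + 1 / 4 ≤ γ B + 1 / 4 := by
      have : (1 / 4 : ℝ≥0∞) + 1 / 4 = 1 / 2 := by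
        rw [← ENNReal.toReal_eq_toReal_iff' (by finiteness) (by finiteness)]
        norm_num [ENNReal.toReal_add]
      rw [this]
      exact hA.trans (h1.trans (by gcongr))
    exact (ENNReal.add_le_add_iff_right (by finiteness)).1 h3
  have hup := stdGaussian_upper_tail hg (m := m)
    (hquarter _ _ (fun x hx => by rw [mem_ofPred_eq, ← hgh hx.2]; exact hx.1) hm₁) ht0 ht
  have hlow := stdGaussian_upper_tail (F := fun x => -g x) (D := D) (m := -m)
    (LipschitzWith.of_dist_le_mul fun x y => by
      rw [dist_neg_neg]; exact hg.dist_le_mul x y)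
    (hquarter _ _ (fun x hx => by
      rw [mem_ofPred_eq, ← hgh hx.2]; exact neg_le_neg hx.1) hm₂) ht0 ht
  have hsub : {x | 5 * t * D < |h x - m|}
      ⊆ ({x | m + 5 * t * D < g x} ∪ {x | -m + 5 * t * D < -g x}) ∪ Kᶜ := by
    intro x hx
    by_cases hxK : x ∈ K
    · left
      rw [mem_ofPred_eq, hgh hxK] at hx
      rcases lt_abs.1 hx with h1 | h1
      · left; rw [mem_ofPred_eq]; linarith
      · right; rw [mem_ofPred_eq]; linarith
    · exact Or.inr hxK
  calc γ {x | 5 * t * D < |h x - m|}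
      ≤ (γ {x | m + 5 * t * D < g x} + γ {x | -m + 5 * t * D < -g x}) + γ Kᶜ :=
        (measure_mono hsub).trans ((measure_union_le _ _).trans (by
          gcongr; exact measure_union_le _ _))
    _ ≤ (ENNReal.ofReal (1 / 4 * δ) + ENNReal.ofReal (1 / 4 * δ)) + ENNReal.ofReal (1 / 4 * δ) := by
        gcongr
    _ = ENNReal.ofReal (1 / 4 * δ + 1 / 4 * δ + 1 / 4 * δ) := by
        rw [ENNReal.ofReal_add (by positivity) (by positivity),
          ENNReal.ofReal_add (by positivity) (by positivity)]
    _ ≤ _ := ENNReal.ofReal_le_ofReal (by linarith)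

end Concentration

/-! ### Coordinates of large size under the Gaussian measure -/

section Truncation

variable {n : ℕ}

/-- `excessSum p R x = ∑ i, ((|x i| - R)₊) ^ p`. -/
noncomputable def excessSum (p R : ℝ) (x : EuclideanSpace ℝ (Fin n)) : ℝ :=
  ∑ i, max (|x i| - R) 0 ^ p

theorem excessSum_nonneg (p R : ℝ) (x : EuclideanSpace ℝ (Fin n)) : 0 ≤ excessSum p R x :=
  Finset.sum_nonneg fun _ _ => Real.rpow_nonneg (le_max_right _ _) _

theorem sum_abs_rpow_rpow_le_norm {p : ℝ} (hp : 2 ≤ p) (x : EuclideanSpace ℝ (Fin n)) :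
    (∑ i, |x i| ^ p) ^ (1 / p) ≤ ‖x‖ := by
  have hp0 : 0 < p := by linarith
  have hsum : ∑ i, |x i| ^ p ≤ ‖x‖ ^ p := by
    have hle : ∀ i, |x i| ^ p ≤ ‖x‖ ^ (p - 2) * |x i| ^ 2 := fun i => by
      rcases (abs_nonneg (x i)).eq_or_lt with h | h
      · rw [← h, Real.zero_rpow hp0.ne']; simp
      · have : |x i| ^ p = |x i| ^ (p - 2) * |x i| ^ 2 := by
          rw [← Real.rpow_natCast, ← Real.rpow_add h]; simp
        rw [this]
        have hi : |x i| ≤ ‖x‖ := PiLp.norm_apply_le x i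
        gcongr
    refine (Finset.sum_le_sum fun i _ => hle i).trans ?_
    have hsq : ∑ i, |x i| ^ 2 = ‖x‖ ^ 2 := by
      rw [EuclideanSpace.real_norm_sq_eq]; simp
    rw [← Finset.mul_sum, hsq]
    rcases (norm_nonneg x).eq_or_lt with h | h
    · rw [← h, Real.zero_rpow hp0.ne']; simp
    · rw [← Real.rpow_natCast, ← Real.rpow_add h]; simp
  calc (∑ i, |x i| ^ p) ^ (1 / p) ≤ (‖x‖ ^ p) ^ (1 / p) := by
        refine Real.rpow_le_rpow (Finset.sum_nonneg fun _ _ => by positivity) hsum (by positivity)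
    _ = ‖x‖ := by
        rw [← Real.rpow_mul (norm_nonneg _), mul_one_div_cancel hp0.ne', Real.rpow_one]

theorem lipschitzWith_excessSum_rpow {p : ℝ} (hp : 2 ≤ p) (R : ℝ) :
    LipschitzWith 1 fun x : EuclideanSpace ℝ (Fin n) => excessSum p R x ^ (1 / p) := by
  refine LipschitzWith.of_le_add fun x y => ?_
  have hp0 : 0 < p := by linarith
  have hle : ∀ i, max (|x i| - R) 0 ≤ max (|y i| - R) 0 + |(x - y) i| := fun i => by
    have h1 := abs_sub_abs_le_abs_sub (x i) (y i)
    have h2 : (x - y) i = x i - y i := rfl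
    rw [h2]
    refine max_le ?_ (add_nonneg (le_max_right _ _) (abs_nonneg _))
    linarith [le_max_left (|y i| - R) 0]
  calc excessSum p R x ^ (1 / p)
      ≤ (∑ i, (max (|y i| - R) 0 + |(x - y) i|) ^ p) ^ (1 / p) := by
        refine Real.rpow_le_rpow (excessSum_nonneg _ _ _) (Finset.sum_le_sum fun i _ => ?_)
          (by positivity)
        exact Real.rpow_le_rpow (le_max_right _ _) (hle i) hp0.le
    _ ≤ (∑ i, max (|y i| - R) 0 ^ p) ^ (1 / p) + (∑ i, |(x - y) i| ^ p) ^ (1 / p) :=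
        Real.Lp_add_le_of_nonneg _ (by linarith) (fun _ _ => le_max_right _ _)
          (fun _ _ => abs_nonneg _)
    _ ≤ excessSum p R y ^ (1 / p) + dist x y := by
        rw [dist_eq_norm]
        exact add_le_add le_rfl (sum_abs_rpow_rpow_le_norm hp _)

theorem convex_setOf_excessSum_le {p : ℝ} (hp : 1 ≤ p) (R c : ℝ) :
    Convex ℝ {x : EuclideanSpace ℝ (Fin n) | excessSum p R x ≤ c} := by
  intro x hx y hy a b ha hb hab
  have hle : ∀ i, max (|(a • x + b • y) i| - R) 0
      ≤ a * max (|x i| - R) 0 + b * max (|y i| - R) 0 := fun i => by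
    have h1 : |(a • x + b • y) i| ≤ a * |x i| + b * |y i| := by
      have : (a • x + b • y) i = a * x i + b * y i := by simp
      rw [this]
      refine (abs_add_le _ _).trans ?_
      rw [abs_mul, abs_mul, abs_of_nonneg ha, abs_of_nonneg hb]
    have h2 := mul_le_mul_of_nonneg_left (le_max_left (|x i| - R) 0) ha
    have h3 := mul_le_mul_of_nonneg_left (le_max_left (|y i| - R) 0) hb
    have h4 : R = a * R + b * R := by rw [← add_mul, hab, one_mul]
    refine max_le (by nlinarith) ?_
    have := le_max_right (|x i| - R) 0
    have := le_max_right (|y i| - R) 0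
    positivity
  have hterm : ∀ i, max (|(a • x + b • y) i| - R) 0 ^ p
      ≤ a * max (|x i| - R) 0 ^ p + b * max (|y i| - R) 0 ^ p := fun i =>
    (Real.rpow_le_rpow (le_max_right _ _) (hle i) (by linarith)).trans
      ((convexOn_rpow hp).2 (mem_Ici.2 (le_max_right _ _)) (mem_Ici.2 (le_max_right _ _)) ha hb hab)
  calc excessSum p R (a • x + b • y)
      ≤ a * excessSum p R x + b * excessSum p R y := by
        simp only [excessSum, Finset.mul_sum]
        rw [← Finset.sum_add_distrib]
        exact Finset.sum_le_sum fun i _ => hterm i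
    _ ≤ a * c + b * c := by gcongr <;> assumption
    _ = c := by rw [← add_mul, hab, one_mul]

theorem exists_lintegral_excess_le {p : ℝ} (hp : 0 < p) :
    ∃ C : ℝ, 0 < C ∧ ∀ R : ℝ, 0 ≤ R →
      ∫⁻ x, ENNReal.ofReal (max (|x| - R) 0 ^ p) ∂(gaussianReal 0 1)
        ≤ ENNReal.ofReal (C * Real.exp (-R ^ 2 / 4)) := by
  have hinteg : Integrable (fun x : ℝ => |x| ^ p * Real.exp (x ^ 2 / 4)) (gaussianReal 0 1) := by
    rw [gaussianReal_of_var_ne_zero 0 one_ne_zero,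
      integrable_withDensity_iff (measurable_gaussianPDF 0 1) (ae_of_all _ fun _ => by
        simp [gaussianPDF])]
    obtain ⟨k, hk⟩ := exists_nat_ge p
    have hi₀ := (integrable_exp_neg_mul_sq (b := 1 / 4) (by norm_num)).const_mul
      (√(2 * Real.pi))⁻¹
    have hi₁ := (integrable_rpow_mul_exp_neg_mul_sq (b := 1 / 4) (by norm_num)
      (s := ((2 * k : ℕ) : ℝ)) (by linarith [Nat.cast_nonneg (α := ℝ) (2 * k)])).const_mul
      (√(2 * Real.pi))⁻¹
    refine (hi₀.add hi₁).mono' (Measurable.aestronglyMeasurable (by fun_prop))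
      (ae_of_all _ fun x => ?_)
    have hpow : |x| ^ p ≤ 1 + x ^ (2 * k) := by
      have hx2 : x ^ (2 * k) = |x| ^ (2 * k) := by rw [pow_mul, pow_mul, sq_abs]
      rw [hx2]
      rcases le_total |x| 1 with h | h
      · have := Real.rpow_le_one (abs_nonneg x) h hp.le
        have : 0 ≤ |x| ^ (2 * k) := by positivity
        linarith
      · have h1 : |x| ^ p ≤ |x| ^ ((2 * k : ℕ) : ℝ) := by
          refine Real.rpow_le_rpow_of_exponent_le h ?_
          push_cast
          linarith [Nat.cast_nonneg (α := ℝ) k]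
        rw [Real.rpow_natCast] at h1
        linarith
    have hexp : Real.exp (x ^ 2 / 4) * Real.exp (-(x - 0) ^ 2 / (2 * 1))
        = Real.exp (-(1 / 4) * x ^ 2) := by
      rw [← Real.exp_add]; ring_nf
    rw [toReal_gaussianPDF, gaussianPDFReal, NNReal.coe_one, Real.norm_of_nonneg (by positivity)]
    calc |x| ^ p * Real.exp (x ^ 2 / 4)
          * ((√(2 * Real.pi * 1))⁻¹ * Real.exp (-(x - 0) ^ 2 / (2 * 1)))
        = (√(2 * Real.pi))⁻¹ * (|x| ^ p * Real.exp (-(1 / 4) * x ^ 2)) := by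
          rw [← hexp, mul_one]; ring
      _ ≤ (√(2 * Real.pi))⁻¹ * ((1 + x ^ (2 * k)) * Real.exp (-(1 / 4) * x ^ 2)) := by gcongr
      _ = _ := by
          simp only [Pi.add_apply, Real.rpow_natCast]; ring
  refine ⟨∫ x, |x| ^ p * Real.exp (x ^ 2 / 4) ∂(gaussianReal 0 1) + 1, ?_, fun R hR => ?_⟩
  · have : 0 ≤ ∫ x, |x| ^ p * Real.exp (x ^ 2 / 4) ∂(gaussianReal 0 1) :=
      integral_nonneg fun x => by positivity
    linarith
  calc ∫⁻ x, ENNReal.ofReal (max (|x| - R) 0 ^ p) ∂(gaussianReal 0 1)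
      ≤ ∫⁻ x, ENNReal.ofReal (|x| ^ p * Real.exp (x ^ 2 / 4) * Real.exp (-R ^ 2 / 4))
          ∂(gaussianReal 0 1) := by
        refine lintegral_mono fun x => ENNReal.ofReal_le_ofReal ?_
        rcases le_total (|x| - R) 0 with h | h
        · rw [max_eq_right h, Real.zero_rpow hp.ne']
          positivity
        · rw [max_eq_left h, mul_assoc, ← Real.exp_add]
          have h1 : 1 ≤ Real.exp (x ^ 2 / 4 + -R ^ 2 / 4) := by
            refine Real.one_le_exp ?_
            have : R ^ 2 ≤ |x| ^ 2 := by gcongr; linarith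
            rw [sq_abs] at this
            linarith
          calc (|x| - R) ^ p ≤ |x| ^ p := by gcongr; linarith
            _ ≤ _ := le_mul_of_one_le_right (by positivity) h1
    _ = ENNReal.ofReal ((∫ x, |x| ^ p * Real.exp (x ^ 2 / 4) ∂(gaussianReal 0 1))
          * Real.exp (-R ^ 2 / 4)) := by
        rw [← integral_mul_const, ofReal_integral_eq_lintegral_ofReal (hinteg.mul_const _)
          (ae_of_all _ fun x => by positivity)]
    _ ≤ _ := ENNReal.ofReal_le_ofReal (by gcongr; linarith)

theorem lintegral_excessSum_le {p R M : ℝ}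
    (hM : ∫⁻ x, ENNReal.ofReal (max (|x| - R) 0 ^ p) ∂(gaussianReal 0 1) ≤ ENNReal.ofReal M) :
    ∫⁻ x, ENNReal.ofReal (excessSum p R x) ∂(stdGaussian (EuclideanSpace ℝ (Fin n)))
      ≤ ENNReal.ofReal (n * M) := by
  have hm : Measurable fun y : ℝ => ENNReal.ofReal (max (|y| - R) 0 ^ p) := by fun_prop
  have hmc : ∀ i : Fin n, Measurable fun x : EuclideanSpace ℝ (Fin n) =>
      ENNReal.ofReal (max (|x i| - R) 0 ^ p) := fun i => by fun_prop
  have hsplit : ∀ x : EuclideanSpace ℝ (Fin n), ENNReal.ofReal (excessSum p R x)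
      = ∑ i, ENNReal.ofReal (max (|x i| - R) 0 ^ p) := fun x =>
    ENNReal.ofReal_sum_of_nonneg fun i _ => Real.rpow_nonneg (le_max_right _ _) _
  simp_rw [hsplit]
  rw [lintegral_finsetSum _ fun i _ => hmc i]
  have hi : ∀ i : Fin n, ∫⁻ x, ENNReal.ofReal (max (|x i| - R) 0 ^ p)
      ∂(stdGaussian (EuclideanSpace ℝ (Fin n))) ≤ ENNReal.ofReal M := fun i => by
    rw [← map_pi_eq_stdGaussian, lintegral_map (hmc i) (by fun_prop)]
    have := (measurePreserving_eval (fun _ : Fin n => gaussianReal 0 1) i).lintegral_comp hm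
    simp only [Function.eval] at this
    rw [this]
    exact hM
  refine (Finset.sum_le_sum fun i _ => hi i).trans ?_
  rw [ENNReal.ofReal_mul (by positivity)]
  simp

/-- With large probability, the coordinates of a Gaussian vector of size above
`2 (log (e + n / t ^ p)) ^ (1 / 2)` contribute at most `(c t) ^ p` to the sum of `p`-th powers. -/
theorem exists_stdGaussian_excessSum_tail {p : ℝ} (hp : 2 ≤ p) :
    ∃ c : ℝ, 0 < c ∧ ∀ (n : ℕ) (t : ℝ), 0 < t → 2 * Real.log 2 ≤ t ^ 2 →
      stdGaussian (EuclideanSpace ℝ (Fin n))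
        {x | excessSum p (2 * √(Real.log (Real.exp 1 + n / t ^ p))) x ≤ (c * t) ^ p}ᶜ
        ≤ ENNReal.ofReal (1 / 4 * Real.exp (-t ^ 2 / 2)) := by
  have hp0 : 0 < p := by linarith
  obtain ⟨C, hC, hCR⟩ := exists_lintegral_excess_le hp0
  refine ⟨(2 * C) ^ (1 / p) + 5, by positivity, fun n t ht0 ht => ?_⟩
  set y : ℝ := Real.exp 1 + n / t ^ p
  have htp : 0 < t ^ p := Real.rpow_pos_of_pos ht0 p
  have hy : Real.exp 1 ≤ y := le_add_of_nonneg_right (by positivity)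
  have hy0 : 0 < y := (Real.exp_pos 1).trans_le hy
  have hlog : 0 ≤ Real.log y := by
    have := Real.log_le_log (Real.exp_pos 1) hy
    rw [Real.log_exp] at this
    linarith
  set R : ℝ := 2 * √(Real.log y)
  have hR : Real.exp (-R ^ 2 / 4) = y⁻¹ := by
    have : -R ^ 2 / 4 = -Real.log y := by
      simp only [R]; rw [mul_pow, Real.sq_sqrt hlog]; ring
    rw [this, Real.exp_neg, Real.exp_log hy0]
  set γ := stdGaussian (EuclideanSpace ℝ (Fin n))
  have hmean : ∫⁻ x, ENNReal.ofReal (excessSum p R x) ∂γ ≤ ENNReal.ofReal (C * t ^ p) := by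
    refine (lintegral_excessSum_le (hCR R (by positivity))).trans (ENNReal.ofReal_le_ofReal ?_)
    rw [hR]
    have : (n : ℝ) ≤ t ^ p * y := by
      have : t ^ p * y = t ^ p * Real.exp 1 + n := by simp only [y]; field_simp
      rw [this]
      exact le_add_of_nonneg_left (by positivity)
    calc (n : ℝ) * (C * y⁻¹) ≤ (t ^ p * y) * (C * y⁻¹) := by gcongr
      _ = C * t ^ p := by field_simp
  have hSm : Measurable fun x : EuclideanSpace ℝ (Fin n) => excessSum p R x := by
    unfold excessSum; fun_prop
  have hhalf : γ {x | 2 * C * t ^ p < excessSum p R x} ≤ 1 / 2 := by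
    have hmk := mul_meas_ge_le_lintegral₀ (μ := γ) hSm.ennreal_ofReal.aemeasurable
      (ENNReal.ofReal (2 * C * t ^ p))
    have hsub : γ {x | 2 * C * t ^ p < excessSum p R x}
        ≤ γ {x | ENNReal.ofReal (2 * C * t ^ p) ≤ ENNReal.ofReal (excessSum p R x)} :=
      measure_mono fun x hx => ENNReal.ofReal_le_ofReal (le_of_lt hx)
    have h1 : ENNReal.ofReal (C * t ^ p) * (2 * γ {x | 2 * C * t ^ p < excessSum p R x})
        ≤ ENNReal.ofReal (C * t ^ p) * 1 := by
      rw [mul_one, ← mul_assoc]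
      refine le_trans ?_ (hmk.trans hmean)
      have : ENNReal.ofReal (2 * C * t ^ p) = ENNReal.ofReal (C * t ^ p) * 2 := by
        rw [mul_assoc, mul_comm, ENNReal.ofReal_mul (by positivity)]; simp
      rw [← this]
      exact mul_le_mul' le_rfl hsub
    have h2 := (ENNReal.mul_le_mul_iff_right (by simpa using by positivity)
      ENNReal.ofReal_ne_top).1 h1
    rw [ENNReal.le_div_iff_mul_le (by simp) (by simp), mul_comm]
    exact h2
  have hquarter : 1 / 4 ≤ γ {x | excessSum p R x ^ (1 / p) ≤ (2 * C) ^ (1 / p) * t} := by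
    have hsub : {x : EuclideanSpace ℝ (Fin n) | 2 * C * t ^ p < excessSum p R x}ᶜ
        ⊆ {x | excessSum p R x ^ (1 / p) ≤ (2 * C) ^ (1 / p) * t} := fun x hx => by
      have hx' : excessSum p R x ≤ 2 * C * t ^ p := not_lt.1 hx
      have := Real.rpow_le_rpow (excessSum_nonneg p R x) hx' (by positivity : 0 ≤ 1 / p)
      rwa [Real.mul_rpow (by positivity) (by positivity), ← Real.rpow_mul ht0.le,
        mul_one_div_cancel hp0.ne', Real.rpow_one] at this
    refine le_trans ?_ (measure_mono hsub)
    rw [prob_compl_eq_one_sub (measurableSet_lt measurable_const hSm)]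
    refine le_trans ?_ (tsub_le_tsub_left hhalf 1)
    rw [show (1 : ℝ≥0∞) - 1 / 2 = 1 / 2 by simp]
    gcongr
    norm_num
  refine le_trans (measure_mono fun x hx => ?_)
    (stdGaussian_upper_tail (lipschitzWith_excessSum_rpow hp R) hquarter ht0 ht)
  have hx' : (((2 * C) ^ (1 / p) + 5) * t) ^ p < excessSum p R x := not_le.1 hx
  have := Real.rpow_lt_rpow (by positivity) hx' (by positivity : 0 < 1 / p)
  rw [← Real.rpow_mul (by positivity), mul_one_div_cancel hp0.ne', Real.rpow_one] at this
  rw [mem_ofPred_eq, NNReal.coe_one]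
  linarith

end Truncation

/-! ### The quantile transform -/

section Quantile

theorem cdf_gaussianReal_pos (x : ℝ) : 0 < cdf (gaussianReal 0 1) x := by
  rw [cdf_eq_real, measureReal_def]
  refine ENNReal.toReal_pos (fun h => ?_) (measure_ne_top _ _)
  have := gaussianReal_absolutelyContinuous' 0 one_ne_zero h
  simp at this

theorem cdf_gaussianReal_strictMono : StrictMono (cdf (gaussianReal 0 1)) := by
  intro x y hxy
  have hpos : 0 < (gaussianReal 0 1) (Ioc x y) := by
    refine pos_iff_ne_zero.2 fun h => ?_
    have := gaussianReal_absolutelyContinuous' 0 one_ne_zero h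
    rw [Real.volume_Ioc, ENNReal.ofReal_eq_zero] at this
    linarith
  rw [← measure_cdf (gaussianReal 0 1), StieltjesFunction.measure_Ioc, ENNReal.ofReal_pos] at hpos
  linarith

theorem cdf_gaussianReal_lt_one (x : ℝ) : cdf (gaussianReal 0 1) x < 1 :=
  (cdf_gaussianReal_strictMono (lt_add_one x)).trans_le (cdf_le_one _ _)

theorem continuous_cdf_gaussianReal : Continuous (cdf (gaussianReal 0 1)) := by
  refine continuous_iff_continuousAt.2 fun x => ?_
  have h0 : (cdf (gaussianReal 0 1)).measure {x} = 0 := by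
    have := nullSingletonClass_gaussianReal (μ := 0) (v := 1) one_ne_zero
    rw [measure_cdf]
    exact measure_singleton x
  rw [StieltjesFunction.measure_singleton, ENNReal.ofReal_eq_zero, sub_nonpos] at h0
  refine (cdf (gaussianReal 0 1)).mono.continuousAt_iff_leftLim_eq_rightLim.2 ?_
  rw [StieltjesFunction.rightLim_eq]
  exact le_antisymm ((cdf (gaussianReal 0 1)).mono.leftLim_le le_rfl) h0

theorem gaussianReal_setOf_cdf_le {p : ℝ} (hp0 : 0 ≤ p) (hp1 : p ≤ 1) :
    gaussianReal 0 1 {x | cdf (gaussianReal 0 1) x ≤ p} = ENNReal.ofReal p := by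
  rcases hp0.eq_or_lt with rfl | hp0
  · have : {x | cdf (gaussianReal 0 1) x ≤ 0} = ∅ :=
      eq_empty_of_forall_notMem fun x hx => (cdf_gaussianReal_pos x).not_ge hx
    simp [this]
  rcases hp1.eq_or_lt with rfl | hp1
  · have : {x | cdf (gaussianReal 0 1) x ≤ 1} = univ :=
      eq_univ_of_forall fun x => cdf_le_one _ x
    simp [this]
  obtain ⟨x₀, rfl⟩ : ∃ x, cdf (gaussianReal 0 1) x = p :=
    mem_range_of_exists_le_of_exists_ge continuous_cdf_gaussianReal
      (((tendsto_cdf_atBot _).eventually (gt_mem_nhds hp0)).exists.imp fun _ => le_of_lt)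
      (((tendsto_cdf_atTop _).eventually (lt_mem_nhds hp1)).exists.imp fun _ => le_of_lt)
  rw [ofReal_cdf]
  congr 1
  ext x
  exact cdf_gaussianReal_strictMono.le_iff_le

theorem quantile_le_iff (μ : Measure ℝ) {s : ℝ} (hs0 : 0 < s) (hs1 : s < 1) (t : ℝ) :
    quantile μ s ≤ t ↔ s ≤ cdf μ t := by
  have hne : {t : ℝ | s ≤ cdf μ t}.Nonempty :=
    ((tendsto_cdf_atTop μ).eventually (lt_mem_nhds hs1)).exists.imp fun _ => le_of_lt
  have hbdd : BddBelow {t : ℝ | s ≤ cdf μ t} := by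
    obtain ⟨x, hx⟩ := ((tendsto_cdf_atBot μ).eventually (gt_mem_nhds hs0)).exists
    refine ⟨x, fun y hy => ?_⟩
    by_contra! hlt
    exact absurd (hy.trans (monotone_cdf μ hlt.le)) hx.not_ge
  refine ⟨fun h => ?_, fun h => csInf_le hbdd h⟩
  have hright : Tendsto (cdf μ) (𝓝[>] t) (𝓝 (cdf μ t)) :=
    ((cdf μ).right_continuous t).mono Ioi_subset_Ici_self
  refine ge_of_tendsto hright (eventually_nhdsWithin_of_forall fun u hu => ?_)
  obtain ⟨v, hv, hvu⟩ := exists_lt_of_csInf_lt hne (h.trans_lt hu)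
  exact le_trans hv (monotone_cdf μ hvu.le)

theorem monotone_quantile_cdf_gaussianReal (μ : Measure ℝ) :
    Monotone fun x => quantile μ (cdf (gaussianReal 0 1) x) := fun x y hxy => by
  rw [quantile_le_iff μ (cdf_gaussianReal_pos x) (cdf_gaussianReal_lt_one x)]
  exact (monotone_cdf _ hxy).trans
    ((quantile_le_iff μ (cdf_gaussianReal_pos y) (cdf_gaussianReal_lt_one y) _).1 le_rfl)

/-- The monotone map `F⁻¹ ∘ Φ` transports the standard Gaussian measure to `μ`. -/
theorem map_quantile_cdf_gaussianReal (μ : Measure ℝ) [IsProbabilityMeasure μ] :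
    (gaussianReal 0 1).map (fun x => quantile μ (cdf (gaussianReal 0 1) x)) = μ := by
  have hmeas := (monotone_quantile_cdf_gaussianReal μ).measurable
  refine Measure.ext_of_Iic _ _ fun t => ?_
  rw [Measure.map_apply hmeas measurableSet_Iic, ← ofReal_cdf μ t,
    ← gaussianReal_setOf_cdf_le (cdf_nonneg μ t) (cdf_le_one μ t)]
  congr 1
  ext x
  exact quantile_le_iff μ (cdf_gaussianReal_pos x) (cdf_gaussianReal_lt_one x) t

end Quantile

/-! ### Functions composed with locally Lipschitz changes of coordinates -/

section LocalLipschitz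

theorem eventually_abs_sub_le_of_localLip_le {T : ℝ → ℝ} {s w ε : ℝ}
    (h : localLip T s ≤ ENNReal.ofReal w) (hw : 0 ≤ w) (hε : 0 < ε) :
    ∀ᶠ u in 𝓝 s, |T u - T s| ≤ (w + ε) * |u - s| := by
  have hlt : localLip T s < ENNReal.ofReal (w + ε) :=
    h.trans_lt ((ENNReal.ofReal_lt_ofReal_iff (by linarith)).2 (by linarith))
  obtain ⟨⟨r, hr⟩, hr'⟩ := iInf_lt_iff.1 hlt
  obtain ⟨k, hk, hkw⟩ := sInf_lt_iff.1 hr'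
  filter_upwards [Metric.ball_mem_nhds s hr] with u hu
  have := (hk u hu s (Metric.mem_ball_self hr)).trans
    (mul_le_mul_left hkw.le _)
  rw [edist_dist, edist_dist, ← ENNReal.ofReal_mul (by linarith),
    ENNReal.ofReal_le_ofReal_iff (by positivity), Real.dist_eq, Real.dist_eq] at this
  exact this

theorem continuous_of_localLip_le {T : ℝ → ℝ} {w : ℝ → ℝ} (hw : ∀ s, 0 ≤ w s)
    (h : ∀ s, localLip T s ≤ ENNReal.ofReal (w s)) : Continuous T := by
  refine continuous_iff_continuousAt.2 fun s => tendsto_iff_dist_tendsto_zero.2 ?_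
  have hlim : Tendsto (fun u => (w s + 1) * |u - s|) (𝓝 s) (𝓝 0) := by
    have : Continuous fun u => (w s + 1) * |u - s| := by fun_prop
    simpa using this.tendsto s
  exact squeeze_zero' (Eventually.of_forall fun _ => dist_nonneg)
    (eventually_abs_sub_le_of_localLip_le (h s) (hw s) one_pos) hlim

/-- A function on a segment whose difference quotients are eventually bounded by any number
larger than `c` is `c`-Lipschitz. -/
theorem abs_sub_le_of_eventually_abs_sub_le {φ : ℝ → ℝ} (hφ : Continuous φ) {c : ℝ}
    (h : ∀ u ∈ Ico (0 : ℝ) 1, ∀ r, c < r → ∀ᶠ v in 𝓝 u, |φ v - φ u| ≤ r * |v - u|) :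
    |φ 1 - φ 0| ≤ c := by
  refine le_of_forall_gt_imp_ge_of_dense fun r hr => ?_
  have key := image_norm_le_of_liminf_right_slope_norm_lt_deriv_boundary (a := 0) (b := 1)
    (f := fun u => φ u - φ 0) (f' := fun _ => c) (B := fun u => r * u) (B' := fun _ => r)
    (by fun_prop) ?_ (by simp) (by fun_prop)
    (fun u _ => by simpa using ((hasDerivAt_id u).const_mul r).hasDerivWithinAt)
    (fun u _ _ => hr) (right_mem_Icc.2 zero_le_one)
  · simpa using key
  · intro u hu ρ hρ
    obtain ⟨ρ', h1, h2⟩ := exists_between hρ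
    refine Eventually.frequently ?_
    filter_upwards [nhdsWithin_le_nhds (h u hu ρ' h1), self_mem_nhdsWithin] with v hv huv
    have huv' : 0 < v - u := sub_pos.2 huv
    rw [slope_def_field, div_lt_iff₀ huv']
    calc ‖φ v - φ 0‖ - ‖φ u - φ 0‖ ≤ ‖(φ v - φ 0) - (φ u - φ 0)‖ := norm_sub_norm_le _ _
      _ = |φ v - φ u| := by rw [Real.norm_eq_abs]; ring_nf
      _ ≤ ρ' * |v - u| := hv
      _ < ρ * (v - u) := by rw [abs_of_pos huv']; gcongr

variable {n : ℕ}

/-- If `f` is differentiable, the local Lipschitz constants of the `T i` are bounded by `w i`, and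
the resulting formal bound on the gradient of `x ↦ f (T x)` is at most `D` on a convex set, then
`x ↦ f (T x)` is `D`-Lipschitz there. -/
theorem lipschitzOnWith_comp_of_localLip_le {f : (Fin n → ℝ) → ℝ} (hf : Differentiable ℝ f)
    {T w : Fin n → ℝ → ℝ} (hw : ∀ i s, 0 ≤ w i s)
    (hT : ∀ i s, localLip (T i) s ≤ ENNReal.ofReal (w i s))
    {K : Set (EuclideanSpace ℝ (Fin n))} (hK : Convex ℝ K) {D : NNReal}
    (hD : ∀ x ∈ K, ∑ i, (fderiv ℝ f (fun j => T j (x j)) (Pi.single i 1)) ^ 2 * w i (x i) ^ 2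
      ≤ (D : ℝ) ^ 2) :
    LipschitzOnWith D (fun x : EuclideanSpace ℝ (Fin n) => f fun i => T i (x i)) K := by
  refine LipschitzOnWith.of_dist_le_mul fun y hy x hx => ?_
  have hTc : ∀ i, Continuous (T i) := fun i => continuous_of_localLip_le (hw i) (hT i)
  set z : ℝ → EuclideanSpace ℝ (Fin n) := fun u => x + u • (y - x)
  have hzi : ∀ u i, z u i = x i + u * (y i - x i) := fun u i => by simp [z]
  set φ : ℝ → ℝ := fun u => f fun i => T i (z u i)
  have hcoord : ∀ i, Continuous fun u => z u i := fun i => by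
    simp_rw [hzi]; fun_prop
  have hTz : Continuous fun u => fun i => T i (z u i) :=
    continuous_pi fun i => (hTc i).comp (hcoord i)
  have hφ : Continuous φ := hf.continuous.comp hTz
  have h1 : φ 1 = f fun i => T i (y i) := by simp [φ, hzi]
  have h0 : φ 0 = f fun i => T i (x i) := by simp [φ, hzi]
  rw [← h1, ← h0, Real.dist_eq]
  refine abs_sub_le_of_eventually_abs_sub_le hφ fun u hu r hr => ?_
  have hzK : z u ∈ K := hK.add_smul_sub_mem hx hy ⟨hu.1, hu.2.le⟩
  set b : Fin n → ℝ := fun i => fderiv ℝ f (fun j => T j (z u j)) (Pi.single i 1)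
  have hCS : ∑ i, |b i| * w i (z u i) * |y i - x i| ≤ D * dist y x := by
    have hcs := Finset.sum_mul_sq_le_sq_mul_sq Finset.univ
      (fun i => |b i| * w i (z u i)) (fun i => |y i - x i|)
    have e1 : ∑ i, (|b i| * w i (z u i)) ^ 2 ≤ (D : ℝ) ^ 2 := by
      simpa only [mul_pow, sq_abs] using hD _ hzK
    have e2 : ∑ i, |y i - x i| ^ 2 = dist y x ^ 2 := by
      rw [EuclideanSpace.dist_sq_eq]
      simp [Real.dist_eq]
    refine abs_le_of_sq_le_sq' ?_ (by positivity) |>.2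
    rw [mul_pow]
    refine hcs.trans ?_
    rw [e2]
    gcongr
  obtain ⟨ε, hε0, hε⟩ : ∃ ε > 0, ∑ i, (|b i| + ε) * ((w i (z u i) + ε) * |y i - x i|) < r := by
    have hc : Continuous fun ε : ℝ =>
        ∑ i, (|b i| + ε) * ((w i (z u i) + ε) * |y i - x i|) := by fun_prop
    have hlt : ∑ i, (|b i| + 0) * ((w i (z u i) + 0) * |y i - x i|) < r := by
      simp only [add_zero, ← mul_assoc]
      exact hCS.trans_lt hr
    have hev := (hc.tendsto 0).eventually (gt_mem_nhds hlt)
    have hev' := (nhdsWithin_le_nhds (s := Ioi (0 : ℝ)) hev : _)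
    obtain ⟨ε, h1, h2⟩ := (Filter.Eventually.and hev' self_mem_nhdsWithin).exists
    exact ⟨ε, h2, h1⟩
  have hevT : ∀ᶠ v in 𝓝 u, ∀ i,
      |T i (z v i) - T i (z u i)| ≤ (w i (z u i) + ε) * |y i - x i| * |v - u| := by
    refine eventually_all.2 fun i => ?_
    filter_upwards [((hcoord i).tendsto u).eventually
      (eventually_abs_sub_le_of_localLip_le (hT i (z u i)) (hw i _) hε0)] with v hv
    have : z v i - z u i = (v - u) * (y i - x i) := by rw [hzi, hzi]; ring
    rw [this, abs_mul] at hv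
    linarith
  have hevf : ∀ᶠ v in 𝓝 u, |φ v - φ u - fderiv ℝ f (fun j => T j (z u j))
      ((fun i => T i (z v i)) - fun i => T i (z u i))|
      ≤ ε * ‖(fun i => T i (z v i)) - fun i => T i (z u i)‖ :=
    (hTz.tendsto u).eventually
      ((hf fun j => T j (z u j)).hasFDerivAt.isLittleO.def hε0)
  filter_upwards [hevT, hevf] with v hv1 hv2
  set d : Fin n → ℝ := (fun i => T i (z v i)) - fun i => T i (z u i)
  have hdi : ∀ i, |d i| ≤ (w i (z u i) + ε) * |y i - x i| * |v - u| := hv1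
  have hnorm : ‖d‖ ≤ ∑ i, |d i| :=
    (pi_norm_le_iff_of_nonneg (Finset.sum_nonneg fun _ _ => abs_nonneg _)).2 fun i =>
      Finset.single_le_sum (f := fun i => |d i|) (fun _ _ => abs_nonneg _) (Finset.mem_univ i)
  have hlin : |fderiv ℝ f (fun j => T j (z u j)) d| ≤ ∑ i, |b i| * |d i| := by
    have : d = ∑ i, d i • (Pi.single i (1 : ℝ) : Fin n → ℝ) := by
      ext j
      simp [Finset.sum_apply, Pi.single_apply]
    conv_lhs => rw [this, map_sum]
    refine (Finset.abs_sum_le_sum_abs _ _).trans (le_of_eq (Finset.sum_congr rfl fun i _ => ?_))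
    rw [map_smul, smul_eq_mul, abs_mul, mul_comm]
  calc |φ v - φ u| ≤ |fderiv ℝ f (fun j => T j (z u j)) d| + ε * ‖d‖ := by
        have := abs_sub_abs_le_abs_sub (φ v - φ u) (fderiv ℝ f (fun j => T j (z u j)) d)
        linarith
    _ ≤ ∑ i, |b i| * |d i| + ε * ∑ i, |d i| := by gcongr
    _ = ∑ i, (|b i| + ε) * |d i| := by
        rw [Finset.mul_sum, ← Finset.sum_add_distrib]
        exact Finset.sum_congr rfl fun i _ => by ring
    _ ≤ ∑ i, (|b i| + ε) * ((w i (z u i) + ε) * |y i - x i| * |v - u|) := by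
        gcongr with i
        exact hdi i
    _ = (∑ i, (|b i| + ε) * ((w i (z u i) + ε) * |y i - x i|)) * |v - u| := by
        rw [Finset.sum_mul]
        exact Finset.sum_congr rfl fun i _ => by ring
    _ ≤ r * |v - u| := by gcongr

end LocalLipschitz

/-! ### The main result -/

section Main

variable {n : ℕ}

theorem gradLip_top_le_gradLip_two (f : (Fin n → ℝ) → ℝ) : gradLip ∞ f ≤ gradLip 2 f := by
  refine iSup_mono fun x => ENNReal.ofReal_le_ofReal ?_
  rw [PiLp.norm_toLp]
  exact (pi_norm_le_iff_of_nonneg (norm_nonneg _)).2 fun i => PiLp.norm_apply_le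
    (WithLp.toLp 2 (fun i : Fin n => fderiv ℝ f x (Pi.single i 1))) i

theorem abs_fderiv_single_le_gradLip_top {f : (Fin n → ℝ) → ℝ} (hf : gradLip ∞ f ≠ ∞)
    (x : Fin n → ℝ) (i : Fin n) :
    |fderiv ℝ f x (Pi.single i 1)| ≤ (gradLip ∞ f).toReal := by
  have h := le_iSup (fun x : Fin n → ℝ => ENNReal.ofReal
    ‖WithLp.toLp ∞ (fun i : Fin n => fderiv ℝ f x (Pi.single i 1))‖) x
  have h' := (ENNReal.ofReal_le_iff_le_toReal hf).1 h
  refine le_trans ?_ h'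
  exact PiLp.norm_apply_le (WithLp.toLp ∞ (fun i : Fin n => fderiv ℝ f x (Pi.single i 1))) i

theorem sum_sq_fderiv_single_le_gradLip_two {f : (Fin n → ℝ) → ℝ} (hf : gradLip 2 f ≠ ∞)
    (x : Fin n → ℝ) :
    ∑ i, fderiv ℝ f x (Pi.single i 1) ^ 2 ≤ (gradLip 2 f).toReal ^ 2 := by
  have h := le_iSup (fun x : Fin n → ℝ => ENNReal.ofReal
    ‖WithLp.toLp 2 (fun i : Fin n => fderiv ℝ f x (Pi.single i 1))‖) x
  have h' := (ENNReal.ofReal_le_iff_le_toReal hf).1 h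
  have h2 := pow_le_pow_left₀ (norm_nonneg _) h' 2
  rwa [EuclideanSpace.real_norm_sq_eq] at h2

/-- A random vector with independent coordinates of laws `μs i` has the law of the image of a
standard Gaussian vector by the coordinatewise quantile transforms. -/
theorem measure_preimage_eq_stdGaussian {μs : Fin n → Measure ℝ}
    [∀ i, IsProbabilityMeasure (μs i)] {Ω : Type*} [MeasurableSpace Ω] {P : Measure Ω}
    [IsProbabilityMeasure P] {X : Fin n → Ω → ℝ} (hX : ∀ i, HasLaw (X i) (μs i) P)
    (hind : iIndepFun X P) {A : Set (Fin n → ℝ)} (hA : MeasurableSet A) :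
    P {ω | (fun i => X i ω) ∈ A} = stdGaussian (EuclideanSpace ℝ (Fin n))
      {x | (fun i => quantile (μs i) (cdf (gaussianReal 0 1) (x i))) ∈ A} := by
  have hmeas : ∀ i, Measurable fun x => quantile (μs i) (cdf (gaussianReal 0 1) x) := fun i =>
    (monotone_quantile_cdf_gaussianReal (μs i)).measurable
  have hlaw : P.map (fun ω i => X i ω) = Measure.pi μs := by
    rw [(iIndepFun_iff_map_fun_eq_pi_map fun i => (hX i).aemeasurable).1 hind]
    congr 1
    funext i
    exact (hX i).map_eq
  have hinst : ∀ i, IsProbabilityMeasure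
      ((gaussianReal 0 1).map fun x => quantile (μs i) (cdf (gaussianReal 0 1) x)) := fun i =>
    Measure.isProbabilityMeasure_map (hmeas i).aemeasurable
  have hpi : (Measure.pi fun _ : Fin n => gaussianReal 0 1).map
      (fun x i => quantile (μs i) (cdf (gaussianReal 0 1) (x i))) = Measure.pi μs := by
    rw [Measure.pi_map_pi fun i => (hmeas i).aemeasurable]
    congr 1
    funext i
    exact map_quantile_cdf_gaussianReal (μs i)
  have hTm : Measurable fun (x : Fin n → ℝ) (i : Fin n) =>
      quantile (μs i) (cdf (gaussianReal 0 1) (x i)) :=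
    measurable_pi_lambda _ fun i => (hmeas i).comp (measurable_pi_apply i)
  have hTm' : Measurable fun (x : EuclideanSpace ℝ (Fin n)) (i : Fin n) =>
      quantile (μs i) (cdf (gaussianReal 0 1) (x i)) :=
    measurable_pi_lambda _ fun i => (hmeas i).comp (by fun_prop)
  have hXm : AEMeasurable (fun ω i => X i ω) P :=
    aemeasurable_pi_lambda _ fun i => (hX i).aemeasurable
  calc P {ω | (fun i => X i ω) ∈ A} = P.map (fun ω i => X i ω) A :=
        (Measure.map_apply_of_aemeasurable hXm hA).symm
    _ = (Measure.pi fun _ : Fin n => gaussianReal 0 1)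
          {x | (fun i => quantile (μs i) (cdf (gaussianReal 0 1) (x i))) ∈ A} := by
        rw [hlaw, ← hpi, Measure.map_apply hTm hA]
        rfl
    _ = _ := by
        rw [← map_pi_eq_stdGaussian]
        exact (Measure.map_apply (by fun_prop) (hTm' hA)).symm

/-- The gradient estimate: on the set where `excessSum (2 * a) (2 * ℓ)` is at most
`(c t) ^ (2 a)`, the weighted sum of squares is controlled by the `ℓ²` and `ℓ^∞` bounds. -/
theorem sum_sq_mul_weight_le {a c t ℓ A₂ A : ℝ} (ha : 0 < a) (hc : 0 < c) (ht : 0 < t)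
    (hℓ : 1 ≤ ℓ) (hA₂ : 0 ≤ A₂) (hA : 0 ≤ A) {b : Fin n → ℝ} (hb₂ : ∑ i, b i ^ 2 ≤ A₂ ^ 2)
    (hb : ∀ i, |b i| ≤ A) {x : EuclideanSpace ℝ (Fin n)}
    (hx : excessSum (2 * a) (2 * ℓ) x ≤ (c * t) ^ (2 * a)) :
    ∑ i, b i ^ 2 * ((1 + |x i|) ^ a) ^ 2
      ≤ ((6 ^ a + (2 * c) ^ a) * ℓ ^ a * (A₂ + t ^ a * A)) ^ 2 := by
  have hℓ0 : 0 < ℓ := by linarith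
  have hsq : ∀ y : ℝ, 0 ≤ y → (y ^ a) ^ 2 = y ^ (2 * a) := fun y hy => by
    rw [← Real.rpow_natCast, ← Real.rpow_mul hy]; congr 1; push_cast; ring
  have hw : ∀ i, ((1 + |x i|) ^ a) ^ 2
      ≤ (6 * ℓ) ^ (2 * a) + 2 ^ (2 * a) * max (|x i| - 2 * ℓ) 0 ^ (2 * a) := fun i => by
    rw [hsq _ (by positivity)]
    set v := max (|x i| - 2 * ℓ) 0
    have hv0 : 0 ≤ v := le_max_right _ _
    have hle : 1 + |x i| ≤ 3 * ℓ + v := by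
      have := le_max_left (|x i| - 2 * ℓ) 0
      simp only [v]
      linarith
    rcases le_total v (3 * ℓ) with h | h
    · calc (1 + |x i|) ^ (2 * a) ≤ (6 * ℓ) ^ (2 * a) := by gcongr; linarith
        _ ≤ _ := le_add_of_nonneg_right (by positivity)
    · calc (1 + |x i|) ^ (2 * a) ≤ (2 * v) ^ (2 * a) := by gcongr; linarith
        _ = 2 ^ (2 * a) * v ^ (2 * a) := Real.mul_rpow (by norm_num) hv0
        _ ≤ _ := le_add_of_nonneg_left (by positivity)
  set L := ℓ ^ a
  have hL : 1 ≤ L := Real.one_le_rpow hℓ ha.le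
  have h6 : (6 * ℓ) ^ (2 * a) = (6 ^ a * L) ^ 2 := by
    rw [← Real.mul_rpow (by norm_num) hℓ0.le, hsq _ (by positivity)]
  have h2c : 2 ^ (2 * a) * (c * t) ^ (2 * a) = ((2 * c) ^ a * t ^ a) ^ 2 := by
    rw [← Real.mul_rpow (by norm_num) (by positivity), ← Real.mul_rpow (by positivity) ht.le,
      hsq _ (by positivity), mul_assoc]
  calc ∑ i, b i ^ 2 * ((1 + |x i|) ^ a) ^ 2
      ≤ ∑ i, ((6 * ℓ) ^ (2 * a) * b i ^ 2
          + A ^ 2 * 2 ^ (2 * a) * max (|x i| - 2 * ℓ) 0 ^ (2 * a)) := by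
        refine Finset.sum_le_sum fun i _ => ?_
        have hbi : b i ^ 2 ≤ A ^ 2 := by
          rw [← sq_abs (b i)]; exact pow_le_pow_left₀ (abs_nonneg _) (hb i) 2
        have hv0 : 0 ≤ 2 ^ (2 * a) * max (|x i| - 2 * ℓ) 0 ^ (2 * a) := by positivity
        calc b i ^ 2 * ((1 + |x i|) ^ a) ^ 2
            ≤ b i ^ 2 * ((6 * ℓ) ^ (2 * a) + 2 ^ (2 * a) * max (|x i| - 2 * ℓ) 0 ^ (2 * a)) := by
              gcongr; exact hw i
          _ = (6 * ℓ) ^ (2 * a) * b i ^ 2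
                + b i ^ 2 * (2 ^ (2 * a) * max (|x i| - 2 * ℓ) 0 ^ (2 * a)) := by ring
          _ ≤ _ := by rw [mul_assoc (A ^ 2)]; gcongr
    _ = (6 * ℓ) ^ (2 * a) * ∑ i, b i ^ 2 + A ^ 2 * 2 ^ (2 * a) * excessSum (2 * a) (2 * ℓ) x := by
        rw [Finset.sum_add_distrib, ← Finset.mul_sum, ← Finset.mul_sum, excessSum]
    _ ≤ (6 * ℓ) ^ (2 * a) * A₂ ^ 2 + A ^ 2 * 2 ^ (2 * a) * (c * t) ^ (2 * a) := by gcongr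
    _ = (6 ^ a * L * A₂) ^ 2 + ((2 * c) ^ a * t ^ a * A) ^ 2 := by
        rw [mul_assoc (A ^ 2), h2c, h6]; ring
    _ ≤ (6 ^ a * L * A₂ + (2 * c) ^ a * t ^ a * A) ^ 2 := by
        have h1 : 0 ≤ 6 ^ a * L * A₂ := by positivity
        have h2 : 0 ≤ (2 * c) ^ a * t ^ a * A := by positivity
        nlinarith [mul_nonneg h1 h2]
    _ ≤ _ := by
        have h1 : (2 * c) ^ a * t ^ a * A ≤ L * ((2 * c) ^ a * t ^ a * A) :=
          le_mul_of_one_le_left (by positivity) hL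
        have h2 : 0 ≤ 6 ^ a * L * (t ^ a * A) := by positivity
        have h3 : 0 ≤ (2 * c) ^ a * L * A₂ := by positivity
        refine pow_le_pow_left₀ (by positivity) ?_ 2
        nlinarith

end Main

theorem stmt_18 (q : ℝ) (hq0 : 0 < q) (hq1 : q < 1) :
    ∃ C : ℝ, 0 < C ∧
      ∀ (n : ℕ) (μs : Fin n → Measure ℝ) [∀ i, IsProbabilityMeasure (μs i)],
      (∀ (i : Fin n) (s : ℝ),
        localLip (fun x : ℝ => quantile (μs i) (cdf (gaussianReal 0 1) x)) s ≤
          ENNReal.ofReal ((1 + |s|) ^ (-1 + 2 / q))) →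
      ∀ (f : (Fin n → ℝ) → ℝ), Differentiable ℝ f →
      ∀ (Ω : Type*) [MeasurableSpace Ω] (P : Measure Ω) [IsProbabilityMeasure P]
        (X : Fin n → Ω → ℝ), (∀ i, HasLaw (X i) (μs i) P) → iIndepFun X P →
      ∀ m : ℝ, IsMedian m (fun ω => f (fun i => X i ω)) P →
      ∀ t : ℝ, 0 < t →
        P {ω | ENNReal.ofReal
              (C * Real.log (Real.exp 1 + (n : ℝ) / t ^ (-2 + 4 / q)) ^ (1 / q - 1 / 2)) *
              (ENNReal.ofReal t * gradLip 2 f + ENNReal.ofReal (t ^ (2 / q)) * gradLip ∞ f) <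
            ENNReal.ofReal |f (fun i => X i ω) - m|} ≤
          ENNReal.ofReal (2 * Real.exp (-t ^ 2 / 2)) := by
  set a : ℝ := -1 + 2 / q with ha_def
  have hq2 : 2 < 2 / q := by rw [lt_div_iff₀ hq0]; linarith
  have ha : 1 < a := by linarith
  have e1 : -2 + 4 / q = 2 * a := by rw [ha_def]; ring
  have e2 : 1 / q - 1 / 2 = a / 2 := by rw [ha_def]; ring
  have e3 : 2 / q = 1 + a := by rw [ha_def]; ring
  obtain ⟨c, hc, hctail⟩ := exists_stdGaussian_excessSum_tail (p := 2 * a) (by linarith)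
  rw [e1, e2, e3]
  refine ⟨5 * (6 ^ a + (2 * c) ^ a), by positivity, ?_⟩
  intro n μs _ hT f hf Ω _ P _ X hX hind m hm t ht
  set y : ℝ := Real.exp 1 + n / t ^ (2 * a)
  have hlog : 1 ≤ Real.log y := by
    have hy : Real.exp 1 ≤ y := le_add_of_nonneg_right (by positivity)
    have := Real.log_le_log (Real.exp_pos 1) hy
    rwa [Real.log_exp] at this
  set ℓ : ℝ := √(Real.log y)
  have hℓ : 1 ≤ ℓ := Real.one_le_sqrt.2 hlog
  have hℓa : Real.log y ^ (a / 2) = ℓ ^ a := by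
    simp only [ℓ]
    rw [Real.sqrt_eq_rpow, ← Real.rpow_mul (by linarith)]
    congr 1
    ring
  rw [hℓa]
  by_cases h2 : gradLip 2 f = ∞
  · have hempty : {ω | ENNReal.ofReal (5 * (6 ^ a + (2 * c) ^ a) * ℓ ^ a) *
        (ENNReal.ofReal t * gradLip 2 f + ENNReal.ofReal (t ^ (1 + a)) * gradLip ∞ f) <
        ENNReal.ofReal |f (fun i => X i ω) - m|} = ∅ := by
      refine eq_empty_of_forall_notMem fun ω hω => ?_
      have hC : ENNReal.ofReal (5 * (6 ^ a + (2 * c) ^ a) * ℓ ^ a) ≠ 0 :=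
        (ENNReal.ofReal_pos.2 (by positivity)).ne'
      rw [mem_ofPred_eq, h2, ENNReal.mul_top (ENNReal.ofReal_pos.2 ht).ne', top_add,
        ENNReal.mul_top hC] at hω
      exact not_top_lt hω
    rw [hempty]
    simp
  have hinf : gradLip ∞ f ≠ ∞ := ne_top_of_le_ne_top h2 (gradLip_top_le_gradLip_two f)
  rcases lt_or_ge (t ^ 2) (2 * Real.log 2) with hts | hts
  · refine prob_le_one.trans ?_
    rw [← ENNReal.ofReal_one]
    refine ENNReal.ofReal_le_ofReal ?_
    have : (1 : ℝ) / 2 ≤ Real.exp (-t ^ 2 / 2) := by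
      rw [one_div, ← Real.exp_log (show (0 : ℝ) < 2⁻¹ by norm_num), Real.log_inv]
      exact Real.exp_le_exp.2 (by linarith)
    linarith
  set A₂ := (gradLip 2 f).toReal
  set A := (gradLip ∞ f).toReal
  have hA₂ : 0 ≤ A₂ := ENNReal.toReal_nonneg
  have hA : 0 ≤ A := ENNReal.toReal_nonneg
  set Dr : ℝ := (6 ^ a + (2 * c) ^ a) * ℓ ^ a * (A₂ + t ^ a * A)
  have hDr : 0 ≤ Dr := by positivity
  set D : NNReal := ⟨Dr, hDr⟩
  have hDc : (D : ℝ) = Dr := rfl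
  have hset : {ω | ENNReal.ofReal (5 * (6 ^ a + (2 * c) ^ a) * ℓ ^ a) *
      (ENNReal.ofReal t * gradLip 2 f + ENNReal.ofReal (t ^ (1 + a)) * gradLip ∞ f) <
      ENNReal.ofReal |f (fun i => X i ω) - m|}
      ⊆ {ω | (fun i => X i ω) ∈ {z | 5 * t * D < |f z - m|}} := by
    intro ω hω
    rw [mem_ofPred_eq, ← ENNReal.ofReal_toReal h2, ← ENNReal.ofReal_toReal hinf,
      ← ENNReal.ofReal_mul ht.le, ← ENNReal.ofReal_mul (by positivity),
      ← ENNReal.ofReal_add (by positivity) (by positivity), ← ENNReal.ofReal_mul (by positivity)]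
      at hω
    have hω' := (ENNReal.ofReal_lt_ofReal_iff_of_nonneg (by positivity)).1 hω
    refine lt_of_le_of_lt (le_of_eq ?_) hω'
    rw [hDc, Real.rpow_add ht, Real.rpow_one]
    simp only [Dr]
    ring
  set T : Fin n → ℝ → ℝ := fun i x => quantile (μs i) (cdf (gaussianReal 0 1) x)
  set h : EuclideanSpace ℝ (Fin n) → ℝ := fun x => f fun i => T i (x i)
  set K : Set (EuclideanSpace ℝ (Fin n)) :=
    {x | excessSum (2 * a) (2 * ℓ) x ≤ (c * t) ^ (2 * a)}
  have hlip : LipschitzOnWith D h K := by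
    refine lipschitzOnWith_comp_of_localLip_le hf (w := fun _ s => (1 + |s|) ^ a)
      (fun _ s => by positivity) hT (convex_setOf_excessSum_le (by linarith) _ _) fun x hx => ?_
    exact sum_sq_mul_weight_le (by linarith) hc ht hℓ hA₂ hA
      (sum_sq_fderiv_single_le_gradLip_two h2 _) (abs_fderiv_single_le_gradLip_top hinf _) hx
  have hfm : Measurable f := hf.continuous.measurable
  have hm₁ : 1 / 2 ≤ stdGaussian (EuclideanSpace ℝ (Fin n)) {x | h x ≤ m} :=
    hm.1.trans_eq (measure_preimage_eq_stdGaussian hX hind (A := {z | f z ≤ m})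
      (measurableSet_le hfm measurable_const))
  have hm₂ : 1 / 2 ≤ stdGaussian (EuclideanSpace ℝ (Fin n)) {x | m ≤ h x} :=
    hm.2.trans_eq (measure_preimage_eq_stdGaussian hX hind (A := {z | m ≤ f z})
      (measurableSet_le measurable_const hfm))
  have hmeas : MeasurableSet {z | 5 * t * D < |f z - m|} :=
    measurableSet_lt measurable_const (by fun_prop)
  refine (measure_mono hset).trans ?_
  rw [measure_preimage_eq_stdGaussian hX hind hmeas]
  exact stdGaussian_concentration_of_lipschitzOnWith hlip hm₁ hm₂ ht hts (hctail n t ht hts)
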